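/- arXiv:0904.2975 — 12 statements merged into one kernel-verified Lean document; each statement's English description precedes it below -/
import Mathlib

section
/- Let m₁ < m₂ < m₃ < m₄ be pairwise coprime integers with m₁ ≥ 2 such that 1/m₁ + 1/m₂ + 1/m₃ + 1/m₄ ≥ 1. Then exactly one of the following holds: (1) (m₁, m₂, m₃) = (2, 3, 5) and m₄ ≥ 7 is coprime to 30; (2) (m₁, m₂, m₃) = (2, 3, 7) and 11 ≤ m₄ ≤ 41 with m₄ coprime to 42; (3) (m₁, m₂, m₃, m₄) = (2, 3, 11, 13). -/
/-- The unit fraction `1 / m` decreases in the positive integer `m`. -/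
theorem one_div_intCast_le {k m : ℤ} (hk : 0 < k) (h : k ≤ m) : 1 / (m : ℚ) ≤ 1 / (k : ℚ) :=
  one_div_le_one_div_of_le (by exact_mod_cast hk) (by exact_mod_cast h)

theorem IsCoprime.emod_ne_zero {a b : ℤ} (h : IsCoprime a b) (ha : 2 ≤ a) : b % a ≠ 0 := by
  intro hb
  have hu := h.isUnit_of_dvd' dvd_rfl (Int.dvd_of_emod_eq_zero hb)
  rcases Int.isUnit_iff.mp hu with h | h <;> omega


/-- Classification of 4-tuples of pairwise coprime integers
`m₁ < m₂ < m₃ < m₄` with `m₁ ≥ 2` and `1/m₁ + 1/m₂ + 1/m₃ + 1/m₄ ≥ 1`. -/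
theorem four_pairwise_coprime_classification
    (m₁ m₂ m₃ m₄ : ℤ)
    (h₁ : 2 ≤ m₁) (h₁₂ : m₁ < m₂) (h₂₃ : m₂ < m₃) (h₃₄ : m₃ < m₄)
    (c₁₂ : IsCoprime m₁ m₂) (c₁₃ : IsCoprime m₁ m₃) (c₁₄ : IsCoprime m₁ m₄)
    (c₂₃ : IsCoprime m₂ m₃) (c₂₄ : IsCoprime m₂ m₄) (c₃₄ : IsCoprime m₃ m₄)
    (hsum : 1 / (m₁ : ℚ) + 1 / (m₂ : ℚ) + 1 / (m₃ : ℚ) + 1 / (m₄ : ℚ) ≥ 1) :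
    (( (m₁ = 2 ∧ m₂ = 3 ∧ m₃ = 5 ∧ 7 ≤ m₄ ∧ IsCoprime m₄ 30)
        ∧ ¬(m₁ = 2 ∧ m₂ = 3 ∧ m₃ = 7 ∧ 11 ≤ m₄ ∧ m₄ ≤ 41 ∧ IsCoprime m₄ 42)
        ∧ ¬(m₁ = 2 ∧ m₂ = 3 ∧ m₃ = 11 ∧ m₄ = 13))
      ∨ (¬(m₁ = 2 ∧ m₂ = 3 ∧ m₃ = 5 ∧ 7 ≤ m₄ ∧ IsCoprime m₄ 30)
        ∧ (m₁ = 2 ∧ m₂ = 3 ∧ m₃ = 7 ∧ 11 ≤ m₄ ∧ m₄ ≤ 41 ∧ IsCoprime m₄ 42)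
        ∧ ¬(m₁ = 2 ∧ m₂ = 3 ∧ m₃ = 11 ∧ m₄ = 13))
      ∨ (¬(m₁ = 2 ∧ m₂ = 3 ∧ m₃ = 5 ∧ 7 ≤ m₄ ∧ IsCoprime m₄ 30)
        ∧ ¬(m₁ = 2 ∧ m₂ = 3 ∧ m₃ = 7 ∧ 11 ≤ m₄ ∧ m₄ ≤ 41 ∧ IsCoprime m₄ 42)
        ∧ (m₁ = 2 ∧ m₂ = 3 ∧ m₃ = 11 ∧ m₄ = 13))) := by
  obtain rfl : m₁ = 2 := by
    by_contra hne
    have b₁ := one_div_intCast_le (k := 3) (m := m₁) (by norm_num) (by omega)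
    have b₂ := one_div_intCast_le (k := 4) (m := m₂) (by norm_num) (by omega)
    have b₃ := one_div_intCast_le (k := 5) (m := m₃) (by norm_num) (by omega)
    have b₄ := one_div_intCast_le (k := 6) (m := m₄) (by norm_num) (by omega)
    norm_num at b₁ b₂ b₃ b₄ hsum
    linarith
  have o₂ := c₁₂.emod_ne_zero le_rfl
  have o₃ := c₁₃.emod_ne_zero le_rfl
  have o₄ := c₁₄.emod_ne_zero le_rfl
  obtain rfl : m₂ = 3 := by
    by_contra hne
    have b₂ := one_div_intCast_le (k := 5) (m := m₂) (by norm_num) (by omega)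
    have b₃ := one_div_intCast_le (k := 7) (m := m₃) (by norm_num) (by omega)
    have b₄ := one_div_intCast_le (k := 9) (m := m₄) (by norm_num) (by omega)
    norm_num at b₂ b₃ b₄ hsum
    linarith
  have t₃ := c₂₃.emod_ne_zero (by norm_num)
  have t₄ := c₂₄.emod_ne_zero (by norm_num)
  have hm₃ : m₃ ≤ 12 := by
    by_contra! hlt
    have b₃ := one_div_intCast_le (k := 13) (m := m₃) (by norm_num) (by omega)
    have b₄ := one_div_intCast_le (k := 14) (m := m₄) (by norm_num) (by omega)
    norm_num at b₃ b₄ hsum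
    linarith
  have hprod : IsCoprime m₄ (2 * 3 * m₃) :=
    (c₁₄.symm.mul_right c₂₄.symm).mul_right c₃₄.symm
  obtain rfl | rfl | rfl : m₃ = 5 ∨ m₃ = 7 ∨ m₃ = 11 := by omega
  · norm_num at hprod
    exact Or.inl ⟨⟨rfl, rfl, rfl, by omega, hprod⟩, by omega, by omega⟩
  · norm_num at hprod
    have hm₄ : m₄ ≤ 42 := by
      by_contra! hlt
      have b₄ := one_div_intCast_le (k := 43) (m := m₄) (by norm_num) (by omega)
      norm_num at b₄ hsum
      linarith
    exact Or.inr (Or.inl ⟨by omega, ⟨rfl, rfl, rfl, by omega, by omega, hprod⟩, by omega⟩)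
  · have hm₄ : m₄ ≤ 13 := by
      by_contra! hlt
      have b₄ := one_div_intCast_le (k := 14) (m := m₄) (by norm_num) (by omega)
      norm_num at b₄ hsum
      linarith
    exact Or.inr (Or.inr ⟨by omega, by omega, rfl, rfl, rfl, by omega⟩)
end

section
/- For all integers s, u, v, w not all zero, one has 2s² + 5u² + 5v² + 5w² − 5sw − 5uv − 5vw ≥ 2. In particular the quaternary quadratic form 2s² + 5u² + 5v² + 5w² − 5sw − 5uv − 5vw is positive definite on ℤ⁴ and never takes the value 1. -/
/-- For integers `s, u, v, w` not all zero,
`2s² + 5u² + 5v² + 5w² − 5sw − 5uv − 5vw ≥ 2`. -/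
theorem quadform_five_ge_two (s u v w : ℤ)
    (h : ¬(s = 0 ∧ u = 0 ∧ v = 0 ∧ w = 0)) :
    2 ≤ 2 * s ^ 2 + 5 * u ^ 2 + 5 * v ^ 2 + 5 * w ^ 2
        - 5 * s * w - 5 * u * v - 5 * v * w := by
  set q := 2 * s ^ 2 + 5 * u ^ 2 + 5 * v ^ 2 + 5 * w ^ 2
    - 5 * s * w - 5 * u * v - 5 * v * w with hq
  have key : 24 * q = 30 * (2 * u - v) ^ 2 + 10 * (3 * v - 2 * w) ^ 2
      + 5 * (4 * w - 3 * s) ^ 2 + 3 * s ^ 2 := by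
    rw [hq]; ring
  have h₁ := sq_nonneg (2 * u - v)
  have h₂ := sq_nonneg (3 * v - 2 * w)
  have h₃ := sq_nonneg (4 * w - 3 * s)
  have h₄ := sq_nonneg s
  have pos : 0 < q := by
    by_contra hle
    have e₁ : 2 * u - v = 0 := pow_eq_zero_iff two_ne_zero |>.1 (by linarith)
    have e₂ : 3 * v - 2 * w = 0 := pow_eq_zero_iff two_ne_zero |>.1 (by linarith)
    have e₃ : 4 * w - 3 * s = 0 := pow_eq_zero_iff two_ne_zero |>.1 (by linarith)
    have e₄ : s = 0 := pow_eq_zero_iff two_ne_zero |>.1 (by linarith)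
    exact h (by lia)
  -- Modulo 5 the form is `2s²`, which never takes the value 1.
  have ne_one : q ≠ 1 := by
    intro h_one
    have hcast : (2 * (s : ZMod 5) ^ 2) = 1 := by
      have hz := congrArg (Int.cast : ℤ → ZMod 5) (hq.symm.trans h_one)
      push_cast at hz
      have five : (5 : ZMod 5) = 0 := rfl
      simpa [five] using hz
    exact (by decide : ∀ x : ZMod 5, 2 * x ^ 2 ≠ 1) _ hcast
  lia
end

section
/- For integers s, u, v, w, one has 2s² + 5u² + 5v² + 5w² − 5sw − 5uv − 5vw = 2 if and only if (s, u, v, w) is one of the ten tuples ±(1, 0, 0, 0), ±(4, 1, 2, 3), ±(1, 1, 1, 1), ±(1, 0, 1, 1), ±(1, 0, 0, 1). -/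
/-- An integer point with `∑ aᵢ² + ∑_{i<j} (aᵢ - aⱼ)² = 4` has coordinates in `{-1, 0, 1}`. -/
theorem mem_Icc_of_sum_sq_add_sum_sq_sub_eq_four {a b c d : ℤ}
    (h : a ^ 2 + b ^ 2 + c ^ 2 + d ^ 2 + (a - b) ^ 2 + (a - c) ^ 2 + (a - d) ^ 2
      + (b - c) ^ 2 + (b - d) ^ 2 + (c - d) ^ 2 = 4) :
    -1 ≤ a ∧ a ≤ 1 := by
  have h5 : 5 * a ^ 2 ≤ 8 := by
    linarith [sq_nonneg (a - 2 * b), sq_nonneg (a - 2 * c), sq_nonneg (a - 2 * d),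
      sq_nonneg (b - c), sq_nonneg (b - d), sq_nonneg (c - d)]
  constructor <;> nlinarith


/-- `2s² + 5u² + 5v² + 5w² − 5sw − 5uv − 5vw = 2` iff `(s,u,v,w)` is one of
`±(1,0,0,0), ±(4,1,2,3), ±(1,1,1,1), ±(1,0,1,1), ±(1,0,0,1)`. -/
theorem quadform_five_eq_two (s u v w : ℤ) :
    2 * s ^ 2 + 5 * u ^ 2 + 5 * v ^ 2 + 5 * w ^ 2
        - 5 * s * w - 5 * u * v - 5 * v * w = 2 ↔
      (s = 1 ∧ u = 0 ∧ v = 0 ∧ w = 0) ∨ (s = -1 ∧ u = 0 ∧ v = 0 ∧ w = 0) ∨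
      (s = 4 ∧ u = 1 ∧ v = 2 ∧ w = 3) ∨ (s = -4 ∧ u = -1 ∧ v = -2 ∧ w = -3) ∨
      (s = 1 ∧ u = 1 ∧ v = 1 ∧ w = 1) ∨ (s = -1 ∧ u = -1 ∧ v = -1 ∧ w = -1) ∨
      (s = 1 ∧ u = 0 ∧ v = 1 ∧ w = 1) ∨ (s = -1 ∧ u = 0 ∧ v = -1 ∧ w = -1) ∨
      (s = 1 ∧ u = 0 ∧ v = 0 ∧ w = 1) ∨ (s = -1 ∧ u = 0 ∧ v = 0 ∧ w = -1) := by
  constructor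
  · intro h
    -- In the successive differences the form is `(∑ aᵢ² + ∑_{i<j} (aᵢ - aⱼ)²) / 2`.
    obtain ⟨b, rfl⟩ : ∃ b, v = u + b := ⟨v - u, by ring⟩
    obtain ⟨c, rfl⟩ : ∃ c, w = u + b + c := ⟨w - (u + b), by ring⟩
    obtain ⟨d, rfl⟩ : ∃ d, s = u + b + c + d := ⟨s - (u + b + c), by ring⟩
    obtain ⟨hu, hu'⟩ := mem_Icc_of_sum_sq_add_sum_sq_sub_eq_four
      (a := u) (b := b) (c := c) (d := d) (by linarith)
    obtain ⟨hb, hb'⟩ := mem_Icc_of_sum_sq_add_sum_sq_sub_eq_four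
      (a := b) (b := u) (c := c) (d := d) (by linarith)
    obtain ⟨hc, hc'⟩ := mem_Icc_of_sum_sq_add_sum_sq_sub_eq_four
      (a := c) (b := u) (c := b) (d := d) (by linarith)
    obtain ⟨hd, hd'⟩ := mem_Icc_of_sum_sq_add_sum_sq_sub_eq_four
      (a := d) (b := u) (c := b) (d := c) (by linarith)
    interval_cases u <;> interval_cases b <;> interval_cases c <;> interval_cases d <;>
      simp_all
  · rintro (h | h | h | h | h | h | h | h | h | h) <;> obtain ⟨rfl, rfl, rfl, rfl⟩ := h <;>
      norm_num
end

section
/- For an integer b ≥ 2, the number 180(5b² − 36b + 48) is a perfect square if and only if b = 8, in which case it equals 120² = 14400. -/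
/-- For an integer `b ≥ 2`, `180(5b² − 36b + 48)` is a perfect square iff `b = 8`,
in which case it equals `120² = 14400`. -/
theorem square_case_6 (b : ℤ) (hb : 2 ≤ b) :
    ((∃ k : ℤ, 180 * (5 * b ^ 2 - 36 * b + 48) = k ^ 2) ↔ b = 8) ∧
      (b = 8 → 180 * (5 * b ^ 2 - 36 * b + 48) = 120 ^ 2) := by
  refine ⟨⟨?_, ?_⟩, ?_⟩
  · rintro ⟨k, hk⟩
    have hdvd : (6 : ℤ) ∣ k := by
      rw [← Int.pow_dvd_pow_iff two_ne_zero]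
      exact ⟨25 * b ^ 2 - 180 * b + 240, by rw [← hk]; ring⟩
    obtain ⟨m, rfl⟩ := hdvd
    have hm : (5 * b - 18) ^ 2 - |m| ^ 2 = 84 := by
      rw [sq_abs]
      linarith
    generalize |m| = n, abs_nonneg m = hn at hm
    have hb12 : b ≤ 12 := by
      by_contra! h
      have hlt : n < 5 * b - 18 := by nlinarith
      nlinarith
    have hn42 : n ≤ 42 := by nlinarith
    interval_cases b <;> first | rfl | (exfalso; interval_cases n <;> omega)
  · rintro rfl
    exact ⟨120, by norm_num⟩
  · rintro rfl
    norm_num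
end

section
/- For an integer b ≥ 2, the number 4(225b² + 480b − 1076) is a perfect square if and only if b = 2, in which case it equals 56² = 3136. -/
/-- For an integer `b ≥ 2`, `4(225b² + 480b − 1076)` is a perfect square iff `b = 2`,
in which case it equals `56² = 3136`. -/
theorem square_case_7 (b : ℤ) (hb : 2 ≤ b) :
    ((∃ k : ℤ, 4 * (225 * b ^ 2 + 480 * b - 1076) = k ^ 2) ↔ b = 2) ∧
      (b = 2 → 4 * (225 * b ^ 2 + 480 * b - 1076) = 56 ^ 2) := by
  refine ⟨⟨?_, ?_⟩, ?_⟩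
  · rintro ⟨k, hk⟩
    rw [← sq_abs k] at hk
    have hk0 := abs_nonneg k
    obtain ⟨d, hd⟩ : ∃ d, d = 30 * b + 32 - |k| := ⟨_, rfl⟩
    have hkd : |k| = 30 * b + 32 - d := by linarith
    rw [hkd] at hk hk0
    have hfac : d * (60 * b + 64 - d) = 5328 := by linear_combination hk
    have hpos : 1 ≤ d := by
      by_contra! h
      nlinarith
    have hle : d ≤ 72 := by
      by_contra! h
      nlinarith
    clear hk hkd hd
    interval_cases d <;> omega
  · rintro rfl
    exact ⟨56, by norm_num⟩
  · rintro rfl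
    norm_num
end

section
/- There is no integer b ≥ 2 for which 180(5b² − 50b + 79) is a perfect square. -/
/-- There is no integer `b ≥ 2` for which `180(5b² − 50b + 79)` is a perfect square. -/
theorem no_square_case_8 :
    ¬ ∃ b : ℤ, 2 ≤ b ∧ ∃ k : ℤ, 180 * (5 * b ^ 2 - 50 * b + 79) = k ^ 2 := by
  rintro ⟨b, -, k, h⟩
  have h5 : (5 : ℤ) ∣ k :=
    Int.Prime.dvd_pow' (n := k) (p := 5) (k := 2) (by norm_num)
      ⟨36 * (5 * b ^ 2 - 50 * b + 79), by rw [← h]; push_cast; ring⟩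
  obtain ⟨m, rfl⟩ := h5
  ring_nf at h
  omega
end

section
/- There is no integer b ≥ 2 for which 180(5b² − 40b + 52) is a perfect square. -/
/-- There is no integer `b ≥ 2` for which `180(5b² − 40b + 52)` is a perfect square. -/
theorem no_square_case_9 :
    ¬ ∃ b : ℤ, 2 ≤ b ∧ ∃ k : ℤ, 180 * (5 * b ^ 2 - 40 * b + 52) = k ^ 2 := by
  rintro ⟨b, -, k, h⟩
  have h5 : (5 : ℤ) ∣ k ^ 2 := ⟨36 * (5 * b ^ 2 - 40 * b + 52), by rw [← h]; ring⟩
  obtain ⟨m, rfl⟩ := Int.Prime.dvd_pow' Nat.prime_five h5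
  push_cast at h
  ring_nf at h
  omega
end

section
/- There is no integer b ≥ 2 for which 36(25b² − 190b + 277) is a perfect square. -/
/-- There is no integer `b ≥ 2` for which `36(25b² − 190b + 277)` is a perfect square. -/
theorem no_square_case_10 :
    ¬ ∃ b : ℤ, 2 ≤ b ∧ ∃ k : ℤ, 36 * (25 * b ^ 2 - 190 * b + 277) = k ^ 2 := by
  rintro ⟨b, hb, k, hk⟩
  have h6 : (6 : ℤ) ∣ k := by
    rw [← Int.pow_dvd_pow_iff (n := 2) two_ne_zero, ← hk]
    norm_num
  obtain ⟨j, rfl⟩ := h6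
  have hj : (5 * b - 19) ^ 2 = |j| ^ 2 + 84 := by
    rw [sq_abs]
    linarith
  have hj0 : 0 ≤ |j| := abs_nonneg j
  generalize |j| = i at hj hj0
  have hb12 : b ≤ 12 := by
    by_contra! h
    have hlt : i < 5 * b - 19 := by nlinarith
    nlinarith
  have hi : i ≤ 41 := by nlinarith
  interval_cases b <;> interval_cases i <;> omega
end

section
/- There is no integer b ≥ 2 for which 4(225b² − 330b + 11) is a perfect square. -/
/-- There is no integer `b ≥ 2` for which `4(225b² − 330b + 11)` is a perfect square. -/
theorem no_square_case_13 :
    ¬ ∃ b : ℤ, 2 ≤ b ∧ ∃ k : ℤ, 4 * (225 * b ^ 2 - 330 * b + 11) = k ^ 2 := by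
  rintro ⟨b, -, k, h⟩
  have hk : (2 : ℤ) ∣ k :=
    Int.prime_two.dvd_of_dvd_pow ⟨2 * (225 * b ^ 2 - 330 * b + 11), by rw [← h]; ring⟩
  obtain ⟨m, rfl⟩ := hk
  have hm : 225 * b ^ 2 - 330 * b + 11 = m ^ 2 := by linarith
  have hmod : ∀ x y : ZMod 4, 225 * x ^ 2 - 330 * x + 11 ≠ y ^ 2 := by decide
  exact hmod b m (by exact_mod_cast congrArg (Int.cast : ℤ → ZMod 4) hm)
end

section
/- There is no integer b ≥ 2 for which 20(45b² − 390b + 593) is a perfect square. -/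
/-- There is no integer `b ≥ 2` for which `20(45b² − 390b + 593)` is a perfect square. -/
theorem no_square_case_14 :
    ¬ ∃ b : ℤ, 2 ≤ b ∧ ∃ k : ℤ, 20 * (45 * b ^ 2 - 390 * b + 593) = k ^ 2 := by
  rintro ⟨b, -, k, h⟩
  have hk : (5 : ℤ) ∣ k :=
    Int.Prime.dvd_pow' (p := 5) (by norm_num) (n := k) (k := 2)
      ⟨4 * (45 * b ^ 2 - 390 * b + 593), by push_cast; linarith⟩
  obtain ⟨m, rfl⟩ := hk
  ring_nf at h
  omega
end

section
/- There is no integer b ≥ 2 for which 4(225b² + 930b − 1201) is a perfect square. -/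
/-- There is no integer `b ≥ 2` for which `4(225b² + 930b − 1201)` is a perfect square. -/
theorem no_square_case_15 :
    ¬ ∃ b : ℤ, 2 ≤ b ∧ ∃ k : ℤ, 4 * (225 * b ^ 2 + 930 * b - 1201) = k ^ 2 := by
  rintro ⟨b, -, k, h⟩
  have hk : Even k := by
    have : Even (k ^ 2) := h ▸ (by decide : Even (4 : ℤ)).mul_right _
    exact (Int.even_pow.mp this).1
  obtain ⟨m, rfl⟩ := hk
  -- A difference of two integer squares is never `2` modulo `4`.
  have hdiff : (15 * b + 31) ^ 2 - m ^ 2 = 2162 := by linarith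
  rcases Int.even_or_odd' (15 * b + 31) with ⟨x, hx | hx⟩ <;>
    rcases Int.even_or_odd' m with ⟨y, hy | hy⟩ <;>
    rw [hx, hy] at hdiff <;> ring_nf at hdiff <;> omega
end

section
/- Let x₁, x₂, x₃, x₄, x₅, x₆ be nonnegative integers and let k be a negative integer such that 93x₁ + 62x₂ + 124x₃ + 112x₄ + 149x₅ + 186x₆ = 187 + 4k. Then x₁ = x₂ = 1, x₃ = x₄ = x₅ = x₆ = 0, and k = −8. -/
/-- The only solution of `93x₁ + 62x₂ + 124x₃ + 112x₄ + 149x₅ + 186x₆ = 187 + 4k`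
in nonnegative integers `x₁,…,x₆` with `k` a negative integer is
`x₁ = x₂ = 1`, `x₃ = x₄ = x₅ = x₆ = 0`, `k = −8`. -/
theorem diophantine_sporadic_one
    (x₁ x₂ x₃ x₄ x₅ x₆ k : ℤ)
    (h₁ : 0 ≤ x₁) (h₂ : 0 ≤ x₂) (h₃ : 0 ≤ x₃) (h₄ : 0 ≤ x₄)
    (h₅ : 0 ≤ x₅) (h₆ : 0 ≤ x₆) (hk : k < 0)
    (heq : 93 * x₁ + 62 * x₂ + 124 * x₃ + 112 * x₄ + 149 * x₅ + 186 * x₆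
            = 187 + 4 * k) :
    x₁ = 1 ∧ x₂ = 1 ∧ x₃ = 0 ∧ x₄ = 0 ∧ x₅ = 0 ∧ x₆ = 0 ∧ k = -8 := by
  have h₃_le : x₃ ≤ 1 := by omega
  have h₄_le : x₄ ≤ 1 := by omega
  obtain rfl : x₆ = 0 := by omega
  have h₂_le : x₂ ≤ 2 := by omega
  have h₁_le : x₁ ≤ 1 := by omega
  have h₅_le : x₅ ≤ 1 := by omega
  interval_cases x₁ <;> interval_cases x₅ <;> interval_cases x₂ <;> interval_cases x₃ <;>
    interval_cases x₄ <;> omega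
end
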